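/- Let N ≥ 2 be an integer, g, u_m real numbers, h a nonzero real number, and α₁ a nonzero real number. Then for every λ ∈ ℝ, det(A^{PHSWME}_p − λ·I_{N+2}) = ((−α₁)^N · N! / (2N+1)!!) · P'_{N+1}((λ − u_m)/α₁) · ((λ − u_m)² − gh − α₁²). -/

import Mathlib

open Polynomial

/-- The Legendre polynomial of degree `n` (Rodrigues' formula), normalized so `P n 1 = 1`. -/
noncomputable def legendre (n : ℕ) : Polynomial ℝ :=
  ((2 ^ n * n.factorial : ℝ))⁻¹ • (derivative^[n] ((X ^ 2 - 1) ^ n))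

/-- Entry `(i,j)` (0-based) of the tridiagonal matrix `A₂`. -/
noncomputable def A2entry (α1 : ℝ) (i j : ℕ) : ℝ :=
  if j = i + 1 then ((i : ℝ) + 3) / (2 * (i : ℝ) + 5) * α1
  else if i = j + 1 then ((j : ℝ) + 1) / (2 * (j : ℝ) + 3) * α1
  else 0

/-- The PHSWME system matrix in primitive variables. -/
noncomputable def APHSWMEp (N : ℕ) (g h um α1 : ℝ) :
    Matrix (Fin (N + 2)) (Fin (N + 2)) ℝ := fun r c =>
  if r.val = 0 then (if c.val = 0 then um else if c.val = 1 then h else 0)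
  else if r.val = 1 then
    (if c.val = 0 then g + α1 ^ 2 / (3 * h)
     else if c.val = 1 then um
     else if c.val = 2 then 2 / 3 * α1 else 0)
  else if c.val = 0 then (if r.val = 3 then -(α1 ^ 2) / (3 * h) else 0)
  else if c.val = 1 then (if r.val = 2 then α1 else 0)
  else (if r = c then um else 0) + A2entry α1 (r.val - 2) (c.val - 2)

theorem Matrix.det_eq_of_last_tridiagonal {R : Type*} [CommRing R] (f : ℕ → ℕ → R) (n : ℕ)
    (hrow : ∀ j < n, f (n + 1) j = 0) (hcol : ∀ i < n, f i (n + 1) = 0) :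
    (Matrix.of fun i j : Fin (n + 2) => f i j).det =
      f (n + 1) (n + 1) * (Matrix.of fun i j : Fin (n + 1) => f i j).det -
        f n (n + 1) * f (n + 1) n * (Matrix.of fun i j : Fin n => f i j).det := by
  have hminor : ((Matrix.of fun i j : Fin (n + 2) => f i j).submatrix Fin.castSucc
      (Fin.last n).castSucc.succAbove).det =
      f n (n + 1) * (Matrix.of fun i j : Fin n => f i j).det := by
    rw [Matrix.det_succ_column _ (Fin.last n), Fin.sum_univ_castSucc, Finset.sum_eq_zero]
    · simp [← two_mul, Matrix.submatrix]
    · intro i _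
      simp [hcol i i.2]
  rw [Matrix.det_succ_row _ (Fin.last (n + 1)), Fin.sum_univ_castSucc, Fin.sum_univ_castSucc,
    Finset.sum_eq_zero]
  · rw [Fin.succAbove_last, hminor]
    have hsign : (-1 : R) ^ (n + 1 + n) = -1 := Odd.neg_one_pow ⟨n, by ring⟩
    simp [hsign, Matrix.submatrix, ← two_mul]
    ring
  · intro j _
    simp [hrow j j.2]

theorem Polynomial.derivative_legendre (n : ℕ) :
    derivative (legendre n) =
      ((2 ^ n * n.factorial : ℝ))⁻¹ • derivative^[n + 1] ((X ^ 2 - 1) ^ n) := by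
  rw [legendre, derivative_smul, Function.iterate_succ_apply']

theorem legendre_normalization_succ (n : ℕ) :
    ((2 ^ n * n.factorial : ℝ))⁻¹ =
      ((2 ^ (n + 1) * (n + 1).factorial : ℝ))⁻¹ * (2 * (n + 1)) := by
  have : (n.factorial : ℝ) ≠ 0 := by positivity
  rw [Nat.factorial_succ, pow_succ]
  push_cast
  field_simp

theorem Polynomial.derivative_X_sq_sub_one_pow_succ (n : ℕ) :
    derivative ((X ^ 2 - 1 : ℝ[X]) ^ (n + 1)) =
      (2 * (n + 1) : ℝ) • ((X ^ 2 - 1) ^ n * X) := by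
  simp [derivative_pow_succ, smul_eq_C_mul, one_add_one_eq_two]
  ring

theorem Polynomial.derivative_X_sq_sub_one_pow_mul_X (n : ℕ) :
    derivative ((X ^ 2 - 1 : ℝ[X]) ^ (n + 1) * X) =
      (2 * n + 3 : ℝ) • (X ^ 2 - 1) ^ (n + 1) + (2 * (n + 1) : ℝ) • (X ^ 2 - 1) ^ n := by
  rw [derivative_mul, derivative_X_sq_sub_one_pow_succ]
  simp [smul_eq_C_mul, map_ofNat C]
  ring

theorem Polynomial.derivative_legendre_succ (n : ℕ) :
    derivative (legendre (n + 1)) =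
      X * derivative (legendre n) + ((n : ℝ[X]) + 1) * legendre n := by
  rw [derivative_legendre, derivative_legendre, legendre, Function.iterate_succ_apply,
    derivative_X_sq_sub_one_pow_succ, iterate_derivative_smul, iterate_derivative_mul_X,
    smul_smul, ← legendre_normalization_succ]
  simp [smul_eq_C_mul]
  ring

theorem Polynomial.derivative_legendre_add_two (n : ℕ) :
    derivative (legendre (n + 2)) =
      (2 * (n : ℝ[X]) + 3) * legendre (n + 1) + derivative (legendre n) := by
  rw [derivative_legendre, derivative_legendre, legendre, Function.iterate_succ_apply,
    derivative_X_sq_sub_one_pow_succ, iterate_derivative_smul, smul_smul,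
    ← legendre_normalization_succ, Function.iterate_succ_apply,
    derivative_X_sq_sub_one_pow_mul_X, iterate_map_add, iterate_derivative_smul,
    iterate_derivative_smul, smul_add, smul_smul _ (2 * ((n : ℝ) + 1)),
    ← legendre_normalization_succ]
  simp [smul_eq_C_mul, map_ofNat C]
  ring

theorem Polynomial.derivative_legendre_recurrence (n : ℕ) :
    ((n : ℝ[X]) + 1) * derivative (legendre (n + 2)) =
      (2 * (n : ℝ[X]) + 3) * X * derivative (legendre (n + 1)) -
        ((n : ℝ[X]) + 2) * derivative (legendre n) := by
  have h1 := derivative_legendre_succ (n + 1)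
  have h2 := derivative_legendre_add_two n
  push_cast at h1
  linear_combination (2 * (n : ℝ[X]) + 3) * h1 - ((n : ℝ[X]) + 2) * h2

/-- Entry `(r, c)` of the PHSWME system matrix with diagonal `um` replaced by `-x`; it does not
depend on the size of the matrix. -/
noncomputable def shiftedEntry (g h x α1 : ℝ) (r c : ℕ) : ℝ :=
  if r = 0 then (if c = 0 then -x else if c = 1 then h else 0)
  else if r = 1 then
    (if c = 0 then g + α1 ^ 2 / (3 * h)
     else if c = 1 then -x
     else if c = 2 then 2 / 3 * α1 else 0)
  else if c = 0 then (if r = 3 then -(α1 ^ 2) / (3 * h) else 0)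
  else if c = 1 then (if r = 2 then α1 else 0)
  else (if r = c then -x else 0) + A2entry α1 (r - 2) (c - 2)

theorem APHSWMEp_sub_smul_one (N : ℕ) (g h um α1 lam : ℝ) :
    APHSWMEp N g h um α1 - lam • (1 : Matrix (Fin (N + 2)) (Fin (N + 2)) ℝ) =
      Matrix.of fun i j : Fin (N + 2) => shiftedEntry g h (lam - um) α1 i j := by
  ext i j
  simp only [Matrix.sub_apply, Matrix.smul_apply, Matrix.one_apply, Matrix.of_apply, APHSWMEp,
    shiftedEntry, smul_eq_mul, Fin.ext_iff]
  split_ifs <;> first | omega | ring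

/-- Determinant of the leading `n × n` block of the shifted PHSWME matrix. -/
noncomputable def shiftedDet (g h x α1 : ℝ) (n : ℕ) : ℝ :=
  (Matrix.of fun i j : Fin n => shiftedEntry g h x α1 i j).det

theorem shiftedDet_add_six (g h x α1 : ℝ) (n : ℕ) :
    shiftedDet g h x α1 (n + 6) = -x * shiftedDet g h x α1 (n + 5) -
      ((n + 3) * (n + 5) / ((2 * n + 7) * (2 * n + 9)) * α1 ^ 2) *
        shiftedDet g h x α1 (n + 4) := by
  rw [shiftedDet, Matrix.det_eq_of_last_tridiagonal]
  · have hd : shiftedEntry g h x α1 (n + 5) (n + 5) = -x := by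
      simp [shiftedEntry, A2entry]
    have hu : shiftedEntry g h x α1 (n + 4) (n + 5) = (n + 5) / (2 * n + 9) * α1 := by
      simp [shiftedEntry, A2entry]
      exact Or.inl (by ring)
    have hl : shiftedEntry g h x α1 (n + 5) (n + 4) = (n + 3) / (2 * n + 7) * α1 := by
      simp [shiftedEntry, A2entry]
      exact Or.inl (by ring)
    rw [hd, hu, hl, shiftedDet, shiftedDet]
    field_simp
  · intro j hj
    simp only [shiftedEntry, A2entry]
    split_ifs <;> first | omega | contradiction | simp
  · intro i hi
    simp only [shiftedEntry, A2entry]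
    split_ifs <;> first | omega | contradiction | simp

theorem shiftedDet_four (g x α1 : ℝ) {h : ℝ} (hh : h ≠ 0) :
    shiftedDet g h x α1 4 = (x ^ 2 - α1 ^ 2 / 5) * (x ^ 2 - g * h - α1 ^ 2) := by
  simp [shiftedDet, Matrix.det_succ_row_zero, Fin.sum_univ_succ, Fin.succAbove, shiftedEntry,
    A2entry]
  field_simp
  ring

theorem shiftedDet_five (g x α1 : ℝ) {h : ℝ} (hh : h ≠ 0) :
    shiftedDet g h x α1 5 =
      -x * (x ^ 2 - 3 * α1 ^ 2 / 7) * (x ^ 2 - g * h - α1 ^ 2) := by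
  simp [shiftedDet, Matrix.det_succ_row_zero, Fin.sum_univ_succ, Fin.succAbove, shiftedEntry,
    A2entry]
  field_simp
  ring

/-- The factor of the characteristic polynomial contributed by the Legendre polynomial. -/
noncomputable def legendreFactor (α1 y : ℝ) (N : ℕ) : ℝ :=
  (-α1) ^ N * (N.factorial : ℝ) / (Nat.doubleFactorial (2 * N + 1) : ℝ) *
    (derivative (legendre (N + 1))).eval y

theorem legendreFactor_add_two (α1 y : ℝ) (n : ℕ) :
    legendreFactor α1 y (n + 2) = -(α1 * y) * legendreFactor α1 y (n + 1) -
      ((n + 1) * (n + 3) / ((2 * n + 3) * (2 * n + 5)) * α1 ^ 2) * legendreFactor α1 y n := by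
  have hrec := congrArg (eval y) (derivative_legendre_recurrence (n + 1))
  simp only [eval_mul, eval_sub, eval_add, eval_natCast, eval_one, eval_ofNat, eval_X] at hrec
  have hn : (n : ℝ) + 2 ≠ 0 := by positivity
  push_cast at hrec
  have hQ : (derivative (legendre (n + 1 + 2))).eval y =
      ((2 * (n + 1) + 3) * y * (derivative (legendre (n + 1 + 1))).eval y -
        (n + 1 + 2) * (derivative (legendre (n + 1))).eval y) / (n + 2) := by
    rw [eq_div_iff hn]
    linear_combination hrec
  have hdf : (Nat.doubleFactorial (2 * n + 1) : ℝ) ≠ 0 := by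
    exact_mod_cast (Nat.doubleFactorial_pos _).ne'
  simp only [legendreFactor, show n + 2 + 1 = n + 1 + 2 from rfl, hQ, Nat.factorial_succ,
    show 2 * (n + 2) + 1 = 2 * n + 1 + 2 + 2 by ring, show 2 * (n + 1) + 1 = 2 * n + 1 + 2 by ring,
    Nat.doubleFactorial_add_two]
  push_cast
  field_simp
  ring

theorem legendre_zero : legendre 0 = 1 := by
  simp [legendre]

theorem Polynomial.derivative_legendre_one : derivative (legendre 1) = 1 := by
  simp [derivative_legendre_succ 0, legendre_zero]

theorem legendreFactor_zero (α1 y : ℝ) : legendreFactor α1 y 0 = 1 := by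
  simp [legendreFactor, derivative_legendre_one]

theorem legendreFactor_one (α1 y : ℝ) : legendreFactor α1 y 1 = -(α1 * y) := by
  have hrec := congrArg (eval y) (derivative_legendre_recurrence 0)
  simp [derivative_legendre_one, legendre_zero] at hrec
  simp [legendreFactor, hrec, Nat.doubleFactorial]
  ring

theorem shiftedDet_eq (g α1 y : ℝ) {h : ℝ} (hh : h ≠ 0) (n : ℕ) :
    shiftedDet g h (α1 * y) α1 (n + 4) =
      legendreFactor α1 y (n + 2) * ((α1 * y) ^ 2 - g * h - α1 ^ 2) := by
  have h2 := legendreFactor_add_two α1 y 0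
  have h3 := legendreFactor_add_two α1 y 1
  norm_num [legendreFactor_zero, legendreFactor_one] at h2
  norm_num [h2, legendreFactor_one] at h3
  induction n using Nat.twoStepInduction with
  | zero =>
    rw [shiftedDet_four g _ α1 hh, h2]
    ring
  | one =>
    rw [shiftedDet_five g _ α1 hh, h3]
    ring
  | more n ih₀ ih₁ =>
    have hrec := legendreFactor_add_two α1 y (n + 2)
    push_cast at hrec
    rw [shiftedDet_add_six, ih₀, ih₁, hrec]
    ring

/-- Characteristic polynomial of the primitive PHSWME system matrix. -/
theorem stmt_10 (N : ℕ) (hN : 2 ≤ N) (g um : ℝ) (h : ℝ) (hh : h ≠ 0)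
    (α1 : ℝ) (hα1 : α1 ≠ 0) (lam : ℝ) :
    (APHSWMEp N g h um α1 - lam • (1 : Matrix (Fin (N + 2)) (Fin (N + 2)) ℝ)).det =
      (-α1) ^ N * (N.factorial : ℝ) / (Nat.doubleFactorial (2 * N + 1) : ℝ) *
        (derivative (legendre (N + 1))).eval ((lam - um) / α1) *
        ((lam - um) ^ 2 - g * h - α1 ^ 2) := by
  obtain ⟨n, rfl⟩ := Nat.exists_eq_add_of_le' hN
  have key := shiftedDet_eq g α1 ((lam - um) / α1) hh n
  rw [mul_div_cancel₀ _ hα1] at key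
  rw [APHSWMEp_sub_smul_one]
  exact key
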